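/- Assume the standing assumptions. Then for all Y, Y′ ∈ 𝒴 and all Z, Z′ ∈ ℝ^{m×n}: d(Y′, Z′) − d(Y, Z) ≥ ⟨G(X(Y,Z)) − εY, Y′ − Y⟩ − ((2σ₂R_X + ε)/2)·‖Y − Y′‖_F² + (r/2)·⟨Z′ − Z, Z′ + Z − 2X(Y′, Z′)⟩, where σ₂ := 2R_X/(r−μ_ρ). -/

import Mathlib

open Matrix

noncomputable section

/-- Frobenius inner product `⟨A,B⟩ = tr(AᵀB)`. -/
def frobInner {m n : ℕ} (A B : Matrix (Fin m) (Fin n) ℝ) : ℝ := (Aᵀ * B).trace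

/-- Frobenius norm. -/
def frobNorm {m n : ℕ} (A : Matrix (Fin m) (Fin n) ℝ) : ℝ := Real.sqrt (frobInner A A)

/-- Spectral (operator) norm of a matrix. -/
def specNorm {m n : ℕ} (A : Matrix (Fin m) (Fin n) ℝ) : ℝ :=
  ‖LinearMap.toContinuousLinearMap (Matrix.toEuclideanLin A)‖

/-- `G(X) := XᵀX − Iₙ`. -/
def Gm {m n : ℕ} (X : Matrix (Fin m) (Fin n) ℝ) : Matrix (Fin n) (Fin n) ℝ := Xᵀ * X - 1

/-- `gradl` is the (Fréchet) gradient of `ℓ` w.r.t. the Frobenius inner product. -/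
def IsGradientOf {m n : ℕ} (gradl : Matrix (Fin m) (Fin n) ℝ → Matrix (Fin m) (Fin n) ℝ)
    (ℓ : Matrix (Fin m) (Fin n) ℝ → ℝ) : Prop :=
  ∀ X : Matrix (Fin m) (Fin n) ℝ, ∀ c : ℝ, 0 < c → ∃ δ : ℝ, 0 < δ ∧
    ∀ H : Matrix (Fin m) (Fin n) ℝ, frobNorm H ≤ δ →
      |ℓ (X + H) - ℓ X - frobInner (gradl X) H| ≤ c * frobNorm H

/-- Augmented Lagrangian `ℒ_ρ(X,Y) = f(X) + ⟨Y, G(X)⟩ + (ρ/2)‖G(X)‖_F²` with `f = ℓ + g`. -/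
def Lag {m n : ℕ} (ℓ g : Matrix (Fin m) (Fin n) ℝ → ℝ) (ρ : ℝ)
    (X : Matrix (Fin m) (Fin n) ℝ) (Y : Matrix (Fin n) (Fin n) ℝ) : ℝ :=
  ℓ X + g X + frobInner Y (Gm X) + ρ / 2 * frobNorm (Gm X) ^ 2

/-- `F(X,Y,Z) = ℒ_ρ(X,Y) − (ε/2)‖Y‖_F² + (r/2)‖X−Z‖_F²`. -/
def Ffun {m n : ℕ} (ℓ g : Matrix (Fin m) (Fin n) ℝ → ℝ) (ρ r ε : ℝ)
    (X : Matrix (Fin m) (Fin n) ℝ) (Y : Matrix (Fin n) (Fin n) ℝ)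
    (Z : Matrix (Fin m) (Fin n) ℝ) : ℝ :=
  Lag ℓ g ρ X Y - ε / 2 * frobNorm Y ^ 2 + r / 2 * frobNorm (X - Z) ^ 2

/-- Dual function `d(Y,Z) = min_{X ∈ 𝒳} F(X,Y,Z)`. -/
def dfun {m n : ℕ} (𝒳 : Set (Matrix (Fin m) (Fin n) ℝ))
    (ℓ g : Matrix (Fin m) (Fin n) ℝ → ℝ) (ρ r ε : ℝ)
    (Y : Matrix (Fin n) (Fin n) ℝ) (Z : Matrix (Fin m) (Fin n) ℝ) : ℝ :=
  sInf ((fun X => Ffun ℓ g ρ r ε X Y Z) '' 𝒳)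

/-- Proximal function `p(Z) = max_{Y ∈ 𝒴} d(Y,Z)`. -/
def pfun {m n : ℕ} (𝒳 : Set (Matrix (Fin m) (Fin n) ℝ))
    (𝒴 : Set (Matrix (Fin n) (Fin n) ℝ))
    (ℓ g : Matrix (Fin m) (Fin n) ℝ → ℝ) (ρ r ε : ℝ)
    (Z : Matrix (Fin m) (Fin n) ℝ) : ℝ :=
  sSup ((fun Y => dfun 𝒳 ℓ g ρ r ε Y Z) '' 𝒴)

/-- Potential function `Φ(X,Y,Z) = F(X,Y,Z) − 2d(Y,Z) + 2p(Z)`. -/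
def Phi {m n : ℕ} (𝒳 : Set (Matrix (Fin m) (Fin n) ℝ))
    (𝒴 : Set (Matrix (Fin n) (Fin n) ℝ))
    (ℓ g : Matrix (Fin m) (Fin n) ℝ → ℝ) (ρ r ε : ℝ)
    (X : Matrix (Fin m) (Fin n) ℝ) (Y : Matrix (Fin n) (Fin n) ℝ)
    (Z : Matrix (Fin m) (Fin n) ℝ) : ℝ :=
  Ffun ℓ g ρ r ε X Y Z - 2 * dfun 𝒳 ℓ g ρ r ε Y Z + 2 * pfun 𝒳 𝒴 ℓ g ρ r ε Z

/-- Linearized augmented Lagrangian `ℒ_{X̄,λ}(X,Y)`. -/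
def LinLag {m n : ℕ} (ℓ g : Matrix (Fin m) (Fin n) ℝ → ℝ)
    (gradl : Matrix (Fin m) (Fin n) ℝ → Matrix (Fin m) (Fin n) ℝ) (ρ lam : ℝ)
    (Xb X : Matrix (Fin m) (Fin n) ℝ) (Y : Matrix (Fin n) (Fin n) ℝ) : ℝ :=
  ℓ Xb + frobInner Y (Gm Xb) + ρ / 2 * frobNorm (Gm Xb) ^ 2 + g X
    + frobInner (gradl Xb) (X - Xb)
    + frobInner ((2 : ℝ) • (Xb * (Y + ρ • Gm Xb))) (X - Xb)
    + 1 / (2 * lam) * frobNorm (X - Xb) ^ 2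

section Frobenius

variable {m n k : ℕ}

theorem frobInner_eq_sum (A B : Matrix (Fin m) (Fin n) ℝ) :
    frobInner A B = ∑ j, ∑ i, A i j * B i j := by
  simp [frobInner, Matrix.trace, Matrix.mul_apply]

theorem frobInner_comm (A B : Matrix (Fin m) (Fin n) ℝ) : frobInner A B = frobInner B A := by
  simp [frobInner_eq_sum, mul_comm]

theorem frobInner_add_left (A B C : Matrix (Fin m) (Fin n) ℝ) :
    frobInner (A + B) C = frobInner A C + frobInner B C := by
  simp [frobInner, Matrix.add_mul]

theorem frobInner_add_right (A B C : Matrix (Fin m) (Fin n) ℝ) :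
    frobInner A (B + C) = frobInner A B + frobInner A C := by
  simp [frobInner, Matrix.mul_add]

theorem frobInner_sub_left (A B C : Matrix (Fin m) (Fin n) ℝ) :
    frobInner (A - B) C = frobInner A C - frobInner B C := by
  simp [frobInner, Matrix.sub_mul]

theorem frobInner_sub_right (A B C : Matrix (Fin m) (Fin n) ℝ) :
    frobInner A (B - C) = frobInner A B - frobInner A C := by
  simp [frobInner, Matrix.mul_sub]

theorem frobInner_smul_left (c : ℝ) (A B : Matrix (Fin m) (Fin n) ℝ) :
    frobInner (c • A) B = c * frobInner A B := by
  simp [frobInner]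

theorem frobInner_smul_right (c : ℝ) (A B : Matrix (Fin m) (Fin n) ℝ) :
    frobInner A (c • B) = c * frobInner A B := by
  simp [frobInner]

theorem frobInner_transpose (A B : Matrix (Fin m) (Fin n) ℝ) :
    frobInner Aᵀ Bᵀ = frobInner A B := by
  rw [frobInner_eq_sum, frobInner_eq_sum, Finset.sum_comm]
  rfl

theorem frobInner_mul_left (A : Matrix (Fin m) (Fin k) ℝ) (B : Matrix (Fin k) (Fin n) ℝ)
    (C : Matrix (Fin m) (Fin n) ℝ) : frobInner (A * B) C = frobInner B (Aᵀ * C) := by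
  simp [frobInner, Matrix.transpose_mul, Matrix.mul_assoc]

theorem frobInner_self_nonneg (A : Matrix (Fin m) (Fin n) ℝ) : 0 ≤ frobInner A A := by
  rw [frobInner_eq_sum]
  exact Finset.sum_nonneg fun _ _ => Finset.sum_nonneg fun _ _ => mul_self_nonneg _

theorem frobNorm_nonneg (A : Matrix (Fin m) (Fin n) ℝ) : 0 ≤ frobNorm A := Real.sqrt_nonneg _

theorem frobNorm_sq (A : Matrix (Fin m) (Fin n) ℝ) : frobNorm A ^ 2 = frobInner A A :=
  Real.sq_sqrt (frobInner_self_nonneg A)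

theorem frobNorm_smul (c : ℝ) (A : Matrix (Fin m) (Fin n) ℝ) :
    frobNorm (c • A) = |c| * frobNorm A := by
  rw [frobNorm, frobInner_smul_left, frobInner_smul_right, ← mul_assoc,
    Real.sqrt_mul (mul_self_nonneg c), Real.sqrt_mul_self_eq_abs, frobNorm]

theorem frobNorm_transpose (A : Matrix (Fin m) (Fin n) ℝ) : frobNorm Aᵀ = frobNorm A := by
  rw [frobNorm, frobNorm, frobInner_transpose]

theorem frobNorm_sub_comm (A B : Matrix (Fin m) (Fin n) ℝ) :
    frobNorm (A - B) = frobNorm (B - A) := by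
  rw [← neg_sub B A, ← neg_one_smul ℝ (B - A), frobNorm_smul]
  simp

/-- Cauchy–Schwarz for the Frobenius inner product. -/
theorem abs_frobInner_le (A B : Matrix (Fin m) (Fin n) ℝ) :
    |frobInner A B| ≤ frobNorm A * frobNorm B := by
  refine abs_le_of_sq_le_sq ?_ (mul_nonneg (frobNorm_nonneg A) (frobNorm_nonneg B))
  rw [mul_pow, frobNorm_sq, frobNorm_sq]
  simp only [frobInner_eq_sum, ← Finset.sum_product', ← sq]
  exact Finset.sum_mul_sq_le_sq_mul_sq _ _ _

open scoped Matrix.Norms.Frobenius in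
theorem frobNorm_eq_norm (A : Matrix (Fin m) (Fin n) ℝ) : frobNorm A = ‖A‖ := by
  rw [Matrix.frobenius_norm_def, frobNorm, frobInner_eq_sum, Finset.sum_comm, Real.sqrt_eq_rpow]
  simp [← sq]

theorem frobNorm_mul_le (A : Matrix (Fin m) (Fin k) ℝ) (B : Matrix (Fin k) (Fin n) ℝ) :
    frobNorm (A * B) ≤ frobNorm A * frobNorm B := by
  simp only [frobNorm_eq_norm]
  exact Matrix.frobenius_norm_mul A B

theorem frobNorm_sq_eq_sum_col (A : Matrix (Fin m) (Fin n) ℝ) :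
    frobNorm A ^ 2 = ∑ j, ‖WithLp.toLp 2 (fun i => A i j)‖ ^ 2 := by
  simp [frobNorm_sq, frobInner_eq_sum, EuclideanSpace.norm_sq_eq, ← sq]

theorem specNorm_nonneg (A : Matrix (Fin m) (Fin n) ℝ) : 0 ≤ specNorm A := norm_nonneg _

theorem frobNorm_mul_le_specNorm (A : Matrix (Fin m) (Fin k) ℝ) (B : Matrix (Fin k) (Fin n) ℝ) :
    frobNorm (A * B) ≤ specNorm A * frobNorm B := by
  refine le_of_sq_le_sq ?_ (mul_nonneg (specNorm_nonneg A) (frobNorm_nonneg B))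
  rw [mul_pow, frobNorm_sq_eq_sum_col, frobNorm_sq_eq_sum_col, Finset.mul_sum]
  refine Finset.sum_le_sum fun j _ => ?_
  rw [← mul_pow]
  refine pow_le_pow_left₀ (norm_nonneg _) ?_ 2
  exact (LinearMap.toContinuousLinearMap (Matrix.toEuclideanLin A)).le_opNorm
    (WithLp.toLp 2 (fun i => B i j))

theorem abs_frobInner_transpose_mul_le (W : Matrix (Fin k) (Fin n) ℝ)
    (X : Matrix (Fin m) (Fin k) ℝ) (H : Matrix (Fin m) (Fin n) ℝ) :
    |frobInner W (Xᵀ * H)| ≤ specNorm X * frobNorm W * frobNorm H := by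
  rw [← frobInner_mul_left]
  exact (abs_frobInner_le _ _).trans
    (mul_le_mul_of_nonneg_right (frobNorm_mul_le_specNorm X W) (frobNorm_nonneg H))

/-- `X ↦ XᵀX − I` is `2R`-Lipschitz on the spectral ball of radius `R`. -/
theorem abs_frobInner_Gm_sub_le {R : ℝ} (W : Matrix (Fin n) (Fin n) ℝ)
    {X X' : Matrix (Fin m) (Fin n) ℝ} (hX : specNorm X ≤ R) (hX' : specNorm X' ≤ R) :
    |frobInner W (Gm X' - Gm X)| ≤ 2 * R * frobNorm W * frobNorm (X' - X) := by
  have hG : Gm X' - Gm X = X'ᵀ * (X' - X) + (Xᵀ * (X' - X))ᵀ := by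
    simp only [Gm, Matrix.mul_sub, Matrix.transpose_sub, Matrix.transpose_mul,
      Matrix.transpose_transpose]
    abel
  have hT : frobInner W (Xᵀ * (X' - X))ᵀ = frobInner Wᵀ (Xᵀ * (X' - X)) := by
    rw [← frobInner_transpose, Matrix.transpose_transpose]
  have h1 := abs_frobInner_transpose_mul_le W X' (X' - X)
  have h2 := abs_frobInner_transpose_mul_le Wᵀ X (X' - X)
  have hnn := mul_nonneg (frobNorm_nonneg W) (frobNorm_nonneg (X' - X))
  rw [frobNorm_transpose] at h2
  rw [hG, frobInner_add_right, hT]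
  refine (abs_add_le _ _).trans ?_
  nlinarith [mul_le_mul_of_nonneg_right hX hnn, mul_le_mul_of_nonneg_right hX' hnn]

end Frobenius

section WeakConvexity

variable {m n : ℕ}

/-- The weak-convexity inequality of modulus `μ` for `h`, at parameter `t` of the segment
from `X` to `X + H`. -/
def SegmentWeaklyConvex (μ : ℝ) (h : Matrix (Fin m) (Fin n) ℝ → ℝ)
    (X H : Matrix (Fin m) (Fin n) ℝ) (t : ℝ) : Prop :=
  h (X + t • H) ≤ (1 - t) * h X + t * h (X + H) + μ / 2 * (t * (1 - t)) * frobNorm H ^ 2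

theorem frobNorm_add_smul_sq (X H : Matrix (Fin m) (Fin n) ℝ) (t : ℝ) :
    frobNorm (X + t • H) ^ 2 =
      (1 - t) * frobNorm X ^ 2 + t * frobNorm (X + H) ^ 2 - t * (1 - t) * frobNorm H ^ 2 := by
  simp only [frobNorm_sq, frobInner_add_left, frobInner_add_right, frobInner_smul_left,
    frobInner_smul_right, frobInner_comm H X]
  ring

theorem Gm_add_smul (X H : Matrix (Fin m) (Fin n) ℝ) (t : ℝ) :
    Gm (X + t • H) = Gm X + t • (Gm (X + H) - Gm X) - (t * (1 - t)) • (Hᵀ * H) := by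
  simp only [Gm, Matrix.transpose_add, Matrix.transpose_smul, Matrix.add_mul, Matrix.mul_add,
    Matrix.smul_mul, Matrix.mul_smul]
  module

theorem SegmentWeaklyConvex.of_convexOn {𝒳 : Set (Matrix (Fin m) (Fin n) ℝ)}
    {g : Matrix (Fin m) (Fin n) ℝ → ℝ} {μ : ℝ}
    (hg : ConvexOn ℝ 𝒳 (fun X => g X + μ / 2 * frobNorm X ^ 2))
    {X H : Matrix (Fin m) (Fin n) ℝ} (hX : X ∈ 𝒳) (hXH : X + H ∈ 𝒳) {t : ℝ}
    (ht0 : 0 ≤ t) (ht1 : t ≤ 1) : SegmentWeaklyConvex μ g X H t := by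
  have h := hg.2 hX hXH (sub_nonneg.2 ht1) ht0 (sub_add_cancel 1 t)
  have hseg : (1 - t) • X + t • (X + H) = X + t • H := by module
  simp only [hseg, smul_eq_mul, frobNorm_add_smul_sq] at h
  unfold SegmentWeaklyConvex
  linarith

theorem SegmentWeaklyConvex.frobInner_Gm {R : ℝ} {Y : Matrix (Fin n) (Fin n) ℝ}
    (hY : frobNorm Y ≤ R) (X H : Matrix (Fin m) (Fin n) ℝ) {t : ℝ}
    (ht0 : 0 ≤ t) (ht1 : t ≤ 1) :
    SegmentWeaklyConvex (2 * R) (fun X => frobInner Y (Gm X)) X H t := by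
  have hs : 0 ≤ t * (1 - t) := mul_nonneg ht0 (sub_nonneg.2 ht1)
  have h1 := (abs_le.1 (abs_frobInner_le Y (Hᵀ * H))).1
  have h2 : frobNorm Y * frobNorm (Hᵀ * H) ≤ R * frobNorm H ^ 2 := by
    have h := frobNorm_mul_le Hᵀ H
    rw [frobNorm_transpose, ← sq] at h
    exact mul_le_mul hY h (frobNorm_nonneg _) ((frobNorm_nonneg Y).trans hY)
  have h3 : -frobInner Y (Hᵀ * H) ≤ R * frobNorm H ^ 2 := by linarith
  have h4 := mul_le_mul_of_nonneg_left h3 hs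
  simp only [SegmentWeaklyConvex, Gm_add_smul, frobInner_sub_right, frobInner_add_right,
    frobInner_smul_right]
  linarith

theorem SegmentWeaklyConvex.frobNorm_Gm_sq {ρ : ℝ} (hρ : 0 ≤ ρ)
    (X H : Matrix (Fin m) (Fin n) ℝ) {t : ℝ} (ht0 : 0 ≤ t) (ht1 : t ≤ 1) :
    SegmentWeaklyConvex (2 * ρ) (fun X => ρ / 2 * frobNorm (Gm X) ^ 2) X H t := by
  have hs : 0 ≤ t * (1 - t) := mul_nonneg ht0 (sub_nonneg.2 ht1)
  have hpsd : 0 ≤ frobInner (Gm (X + t • H)) (Hᵀ * H) + frobNorm H ^ 2 := by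
    have h1 : frobNorm H ^ 2 = frobInner 1 (Hᵀ * H) := by simp [frobNorm_sq, frobInner]
    have h2 : frobInner ((X + t • H)ᵀ * (X + t • H)) (Hᵀ * H)
        = frobNorm ((X + t • H) * Hᵀ) ^ 2 := by
      rw [frobNorm_sq, frobInner_mul_left, frobInner_mul_left, frobInner, frobInner,
        Matrix.transpose_transpose, Matrix.transpose_transpose, ← Matrix.mul_assoc,
        ← Matrix.mul_assoc, Matrix.trace_mul_comm]
      simp only [Matrix.mul_assoc]
    rw [h1, ← frobInner_add_left, Gm, sub_add_cancel, h2]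
    positivity
  have hB := frobInner_self_nonneg (Hᵀ * H)
  have hD := frobInner_self_nonneg (Gm (X + H) - Gm X)
  have hk : 0 ≤ ρ * (t * (1 - t)) * ((frobInner (Gm (X + t • H)) (Hᵀ * H) + frobNorm H ^ 2)
      + t * (1 - t) / 2 * frobInner (Hᵀ * H) (Hᵀ * H)
      + 1 / 2 * frobInner (Gm (X + H) - Gm X) (Gm (X + H) - Gm X)) := by positivity
  simp only [SegmentWeaklyConvex]
  rw [frobNorm_sq (Gm _), frobNorm_sq (Gm X), frobNorm_sq (Gm (X + H))]
  simp only [Gm_add_smul, frobInner_sub_left, frobInner_sub_right, frobInner_add_left,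
    frobInner_add_right, frobInner_smul_left, frobInner_smul_right, frobInner_comm (Hᵀ * H) (Gm _),
    frobInner_comm (Gm (X + H)) (Gm X)] at hk ⊢
  linarith

theorem IsGradientOf.hasDerivAt {gradl : Matrix (Fin m) (Fin n) ℝ → Matrix (Fin m) (Fin n) ℝ}
    {ℓ : Matrix (Fin m) (Fin n) ℝ → ℝ} (hgrad : IsGradientOf gradl ℓ)
    (X H : Matrix (Fin m) (Fin n) ℝ) (t : ℝ) :
    HasDerivAt (fun s : ℝ => ℓ (X + s • H)) (frobInner (gradl (X + t • H)) H) t := by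
  rw [hasDerivAt_iff_isLittleO_nhds_zero, Asymptotics.isLittleO_iff]
  intro c hc
  have hH : 0 < frobNorm H + 1 := by linarith [frobNorm_nonneg H]
  obtain ⟨δ, hδ, h⟩ := hgrad (X + t • H) (c / (frobNorm H + 1)) (by positivity)
  filter_upwards [Metric.ball_mem_nhds (0 : ℝ) (div_pos hδ hH)] with s hs
  rw [mem_ball_zero_iff, Real.norm_eq_abs, lt_div_iff₀ hH] at hs
  have hle : frobNorm (s • H) ≤ |s| * (frobNorm H + 1) := by
    rw [frobNorm_smul]
    nlinarith [abs_nonneg s]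
  have h' := h (s • H) (hle.trans hs.le)
  rw [frobInner_smul_right, add_assoc, ← add_smul] at h'
  rw [Real.norm_eq_abs, Real.norm_eq_abs, smul_eq_mul]
  refine h'.trans ((mul_le_mul_of_nonneg_left hle (by positivity)).trans_eq ?_)
  field_simp

theorem SegmentWeaklyConvex.of_gradient_lipschitz {𝒳 : Set (Matrix (Fin m) (Fin n) ℝ)}
    (h𝒳 : Convex ℝ 𝒳) {gradl : Matrix (Fin m) (Fin n) ℝ → Matrix (Fin m) (Fin n) ℝ}
    {ℓ : Matrix (Fin m) (Fin n) ℝ → ℝ} {L : ℝ} (hgrad : IsGradientOf gradl ℓ)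
    (hLip : ∀ X ∈ 𝒳, ∀ X' ∈ 𝒳, frobNorm (gradl X - gradl X') ≤ L * frobNorm (X - X'))
    {X H : Matrix (Fin m) (Fin n) ℝ} (hX : X ∈ 𝒳) (hXH : X + H ∈ 𝒳) {t : ℝ}
    (ht0 : 0 ≤ t) (ht1 : t ≤ 1) : SegmentWeaklyConvex L ℓ X H t := by
  have hmem : ∀ s ∈ Set.Icc (0 : ℝ) 1, X + s • H ∈ 𝒳 := fun s hs => by
    have := h𝒳 hX hXH (sub_nonneg.2 hs.2) hs.1 (sub_add_cancel 1 s)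
    rwa [show (1 - s) • X + s • (X + H) = X + s • H by module] at this
  have hder : ∀ s : ℝ, HasDerivAt (fun s : ℝ => ℓ (X + s • H) + L / 2 * frobNorm H ^ 2 * s ^ 2)
      (frobInner (gradl (X + s • H)) H + L * frobNorm H ^ 2 * s) s := fun s => by
    refine ((hgrad.hasDerivAt X H s).add
      ((hasDerivAt_pow 2 s).const_mul (L / 2 * frobNorm H ^ 2))).congr_deriv ?_
    push_cast
    ring
  have hconv : ConvexOn ℝ (Set.Icc (0 : ℝ) 1)
      (fun s : ℝ => ℓ (X + s • H) + L / 2 * frobNorm H ^ 2 * s ^ 2) := by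
    refine MonotoneOn.convexOn_of_deriv (convex_Icc 0 1)
      (fun s _ => (hder s).continuousAt.continuousWithinAt)
      (fun s _ => (hder s).differentiableAt.differentiableWithinAt) ?_
    intro a ha b hb hab
    rw [(hder a).deriv, (hder b).deriv]
    have hlip := hLip _ (hmem a (interior_subset ha)) _ (hmem b (interior_subset hb))
    rw [add_sub_add_left_eq_sub, ← sub_smul, frobNorm_smul, abs_sub_comm,
      abs_of_nonneg (sub_nonneg.2 hab)] at hlip
    have hcs := (abs_le.1 (abs_frobInner_le (gradl (X + a • H) - gradl (X + b • H)) H)).2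
    rw [frobInner_sub_left] at hcs
    nlinarith [mul_le_mul_of_nonneg_right hlip (frobNorm_nonneg H)]
  have h := hconv.2 (Set.left_mem_Icc.2 zero_le_one) (Set.right_mem_Icc.2 zero_le_one)
    (sub_nonneg.2 ht1) ht0 (sub_add_cancel 1 t)
  simp only [smul_eq_mul, mul_zero, mul_one, zero_add, zero_smul, add_zero, one_smul] at h
  unfold SegmentWeaklyConvex
  linarith

/-- Quadratic growth at a constrained minimizer: a function that is weakly convex of modulus
`-c` (i.e. `c`-strongly convex) along the segment grows at least like `c / 2 * ‖H‖²`. -/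
theorem quadratic_growth_of_segment {h : Matrix (Fin m) (Fin n) ℝ → ℝ} {c : ℝ}
    {X H : Matrix (Fin m) (Fin n) ℝ}
    (hconv : ∀ t ∈ Set.Ioo (0 : ℝ) 1, SegmentWeaklyConvex (-c) h X H t)
    (hmin : ∀ t ∈ Set.Ioo (0 : ℝ) 1, h X ≤ h (X + t • H)) :
    h X + c / 2 * frobNorm H ^ 2 ≤ h (X + H) := by
  have hbound : ∀ t ∈ Set.Ioo (0 : ℝ) 1,
      h X + c / 2 * frobNorm H ^ 2 * (1 - t) ≤ h (X + H) := fun t ht => by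
    have h1 := (hmin t ht).trans (hconv t ht)
    refine le_of_mul_le_mul_left ?_ ht.1
    linarith
  have htend : Filter.Tendsto (fun t : ℝ => h X + c / 2 * frobNorm H ^ 2 * (1 - t))
      (nhdsWithin 0 (Set.Ioi 0)) (nhds (h X + c / 2 * frobNorm H ^ 2)) := by
    refine (Continuous.tendsto' (by fun_prop) 0 _ (by ring)).mono_left nhdsWithin_le_nhds
  refine le_of_tendsto htend ?_
  filter_upwards [Ioo_mem_nhdsGT (zero_lt_one' ℝ)] with t ht using hbound t ht

end WeakConvexity

section DualFunction

variable {m n : ℕ}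

theorem dfun_eq_of_isMin {𝒳 : Set (Matrix (Fin m) (Fin n) ℝ)} {ℓ g : Matrix (Fin m) (Fin n) ℝ → ℝ}
    {ρ r ε : ℝ} {Y : Matrix (Fin n) (Fin n) ℝ} {Z X : Matrix (Fin m) (Fin n) ℝ}
    (hX : X ∈ 𝒳) (hmin : ∀ X' ∈ 𝒳, Ffun ℓ g ρ r ε X Y Z ≤ Ffun ℓ g ρ r ε X' Y Z) :
    dfun 𝒳 ℓ g ρ r ε Y Z = Ffun ℓ g ρ r ε X Y Z :=
  IsLeast.csInf_eq ⟨Set.mem_image_of_mem _ hX, Set.forall_mem_image.2 hmin⟩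

end DualFunction

/-- Combined dual ascent inequality for the dual function `d`. -/
theorem dual_ascent {m n : ℕ} (hmn : n ≤ m)
    (𝒳 : Set (Matrix (Fin m) (Fin n) ℝ)) (𝒴 : Set (Matrix (Fin n) (Fin n) ℝ))
    (ℓ g : Matrix (Fin m) (Fin n) ℝ → ℝ)
    (gradl : Matrix (Fin m) (Fin n) ℝ → Matrix (Fin m) (Fin n) ℝ)
    (Lℓ Lg ρ RX RY r ε μρ σ₂ : ℝ)
    (h𝒳conv : Convex ℝ 𝒳) (h𝒳cpt : IsCompact 𝒳)
    (h𝒳R : ∀ X ∈ 𝒳, specNorm X ≤ RX)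
    (hgrad : IsGradientOf gradl ℓ) (hgradcont : Continuous gradl)
    (hgradLip : ∀ X ∈ 𝒳, ∀ X' ∈ 𝒳, frobNorm (gradl X - gradl X') ≤ Lℓ * frobNorm (X - X'))
    (hgwc : ConvexOn ℝ 𝒳 (fun X => g X + Lg / 2 * frobNorm X ^ 2))
    (h𝒴symm : ∀ Y ∈ 𝒴, Y.IsSymm) (h𝒴conv : Convex ℝ 𝒴) (h𝒴cpt : IsCompact 𝒴)
    (h𝒴zero : (0 : Matrix (Fin n) (Fin n) ℝ) ∈ 𝒴)
    (h𝒴R : ∀ Y ∈ 𝒴, frobNorm Y ≤ RY)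
    (hρ : 0 ≤ ρ) (hε : 0 < ε)
    (hμρ : μρ = (Lℓ + Lg) + 2 * RY + 2 * ρ) (hr : μρ < r)
    (hσ₂ : σ₂ = 2 * RX / (r - μρ))
    (Xm : Matrix (Fin n) (Fin n) ℝ → Matrix (Fin m) (Fin n) ℝ → Matrix (Fin m) (Fin n) ℝ)
    (hXm : ∀ Y Z, Xm Y Z ∈ 𝒳 ∧ ∀ X' ∈ 𝒳, Ffun ℓ g ρ r ε (Xm Y Z) Y Z ≤ Ffun ℓ g ρ r ε X' Y Z) :
    ∀ Y ∈ 𝒴, ∀ Y' ∈ 𝒴, ∀ Z Z' : Matrix (Fin m) (Fin n) ℝ,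
      dfun 𝒳 ℓ g ρ r ε Y' Z' - dfun 𝒳 ℓ g ρ r ε Y Z
        ≥ frobInner (Gm (Xm Y Z) - ε • Y) (Y' - Y)
          - (2 * σ₂ * RX + ε) / 2 * frobNorm (Y - Y') ^ 2
          + r / 2 * frobInner (Z' - Z) (Z' + Z - (2 : ℝ) • Xm Y' Z') := by
  intro Y hY Y' hY' Z Z'
  have hd : ∀ Y Z, dfun 𝒳 ℓ g ρ r ε Y Z = Ffun ℓ g ρ r ε (Xm Y Z) Y Z := fun Y Z =>
    dfun_eq_of_isMin (hXm Y Z).1 (hXm Y Z).2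
  have hZ : dfun 𝒳 ℓ g ρ r ε Y' Z' - dfun 𝒳 ℓ g ρ r ε Y' Z
      ≥ r / 2 * frobInner (Z' - Z) (Z' + Z - (2 : ℝ) • Xm Y' Z') := by
    have h := (hXm Y' Z).2 _ (hXm Y' Z').1
    rw [← hd] at h
    rw [hd Y' Z']
    have hF : Ffun ℓ g ρ r ε (Xm Y' Z') Y' Z' - Ffun ℓ g ρ r ε (Xm Y' Z') Y' Z
        = r / 2 * frobInner (Z' - Z) (Z' + Z - (2 : ℝ) • Xm Y' Z') := by
      simp only [Ffun, frobNorm_sq (Xm Y' Z' - _), frobInner_sub_left, frobInner_sub_right,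
        frobInner_add_right, frobInner_smul_right, frobInner_comm _ (Xm Y' Z'),
        frobInner_comm Z' Z]
      ring
    linarith
  have hYY : dfun 𝒳 ℓ g ρ r ε Y' Z - dfun 𝒳 ℓ g ρ r ε Y Z
      ≥ frobInner (Gm (Xm Y Z) - ε • Y) (Y' - Y)
        - (2 * σ₂ * RX + ε) / 2 * frobNorm (Y - Y') ^ 2 := by
    rw [hd, hd]
    obtain ⟨hX, hXmin⟩ := hXm Y Z
    have hX' := (hXm Y' Z).1
    set X := Xm Y Z
    set X' := Xm Y' Z
    have hXH : X + (X' - X) ∈ 𝒳 := by rwa [add_sub_cancel]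
    have hgrowth : Ffun ℓ g ρ r ε X Y Z + (r - μρ) / 2 * frobNorm (X' - X) ^ 2
        ≤ Ffun ℓ g ρ r ε X' Y Z := by
      have h := quadratic_growth_of_segment (h := fun X => Ffun ℓ g ρ r ε X Y Z) (c := r - μρ)
        (X := X) (H := X' - X) (fun t ht => ?_) (fun t ht => hXmin _ ?_)
      · simpa only [add_sub_cancel] using h
      · have h1 := SegmentWeaklyConvex.of_gradient_lipschitz h𝒳conv hgrad hgradLip hX hXH
          ht.1.le ht.2.le
        have h2 := SegmentWeaklyConvex.of_convexOn hgwc hX hXH ht.1.le ht.2.le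
        have h3 := SegmentWeaklyConvex.frobInner_Gm (h𝒴R Y hY) X (X' - X) ht.1.le ht.2.le
        have h4 := SegmentWeaklyConvex.frobNorm_Gm_sq hρ X (X' - X) ht.1.le ht.2.le
        have h5 := frobNorm_add_smul_sq (X - Z) (X' - X) t
        rw [sub_add_eq_add_sub, sub_add_eq_add_sub] at h5
        simp only [SegmentWeaklyConvex, Ffun, Lag] at h1 h2 h3 h4 ⊢
        rw [h5, hμρ]
        linarith
      · have h := h𝒳conv hX hXH (sub_nonneg.2 ht.2.le) ht.1.le (sub_add_cancel 1 t)
        rwa [show (1 - t) • X + t • (X + (X' - X)) = X + t • (X' - X) by module] at h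
    have hF : Ffun ℓ g ρ r ε X' Y' Z - Ffun ℓ g ρ r ε X' Y Z
        = frobInner (Gm X - ε • Y) (Y' - Y) - ε / 2 * frobNorm (Y - Y') ^ 2
          + frobInner (Y' - Y) (Gm X' - Gm X) := by
      simp only [Ffun, Lag, frobNorm_sq Y, frobNorm_sq Y', frobNorm_sq (Y - Y'),
        frobInner_sub_left, frobInner_sub_right, frobInner_smul_left, frobInner_comm (Gm X),
        frobInner_comm Y' Y]
      ring
    have hG := (abs_le.1 (abs_frobInner_Gm_sub_le (Y' - Y) (h𝒳R X hX) (h𝒳R X' hX'))).1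
    rw [frobNorm_sub_comm Y' Y] at hG
    have hc : 0 < r - μρ := sub_pos.2 hr
    have hyoung : 2 * RX * frobNorm (Y - Y') * frobNorm (X' - X)
        ≤ σ₂ * RX * frobNorm (Y - Y') ^ 2 + (r - μρ) / 2 * frobNorm (X' - X) ^ 2 := by
      have h : σ₂ * RX * frobNorm (Y - Y') ^ 2 + (r - μρ) / 2 * frobNorm (X' - X) ^ 2
          - 2 * RX * frobNorm (Y - Y') * frobNorm (X' - X)
          = (2 * RX * frobNorm (Y - Y') - (r - μρ) * frobNorm (X' - X)) ^ 2
            / (2 * (r - μρ)) := by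
        rw [hσ₂]
        field_simp
        ring
      have h' : 0 ≤ (2 * RX * frobNorm (Y - Y') - (r - μρ) * frobNorm (X' - X)) ^ 2
            / (2 * (r - μρ)) := by positivity
      linarith
    linarith
  linarith

end
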